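/- Let (X, ρ, 𝒞) be a semi-Cartan graph with GRS Δ, Weyl groupoid 𝒲, and nil-Hecke algebra 𝒩 over a commutative ring 𝕂. Let w ∈ 𝒲(y,x) have length m, and let w = σ_{i_1}^x σ_{i_2} ⋯ σ_{i_m} = σ_{j_1}^x σ_{j_2} ⋯ σ_{j_m} be two reduced expressions of w. Then n_{i_1}^x n_{i_2} ⋯ n_{i_m} = n_{j_1}^x n_{j_2} ⋯ n_{j_m} in 𝒩 (superscripts determined by composability). -/

import Mathlib

open CategoryTheory

noncomputable section

namespace WeylGroupoid

variable {θ : ℕ} {X : Type} [Fintype X] [DecidableEq X]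

/-- A *semi-Cartan graph*: a basic datum `(X, ρ)` together with a compatible bundle of
generalized Cartan matrices. -/
structure SCG (θ : ℕ) (X : Type) [Fintype X] [DecidableEq X] : Type where
  nonempty : Nonempty X
  /-- the involutions `ρ_i` of the basic datum -/
  ρ : Fin θ → X → X
  invol : ∀ i x, ρ i (ρ i x) = x
  /-- the bundle of generalized Cartan matrices `C^x` -/
  C : X → Fin θ → Fin θ → ℤ
  diag : ∀ x i, C x i i = 2
  offdiag : ∀ x i j, i ≠ j → C x i j ≤ 0
  zero_iff : ∀ x i j, i ≠ j → (C x i j = 0 ↔ C x j i = 0)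
  compat : ∀ x i j, C (ρ i x) i j = C x i j

/-- the simple root `α_i ∈ ℤ^θ` -/
def al (θ : ℕ) (i : Fin θ) : Fin θ → ℤ := Pi.single i 1

/-- the reflection `s_i^x` of `ℤ^θ`, `s_i^x (α_j) = α_j - c^x_{ij} α_i` -/
def srefl (G : SCG θ X) (x : X) (i : Fin θ) (v : Fin θ → ℤ) : Fin θ → ℤ :=
  fun k => v k - (if k = i then ∑ j, G.C x i j * v j else 0)

/-- the cone `ℕ₀ α_i + ℕ₀ α_j` -/
def pairCone (θ : ℕ) (i j : Fin θ) : Set (Fin θ → ℤ) :=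
  {v | ∃ a b : ℕ, v = (a : ℤ) • al θ i + (b : ℤ) • al θ j}

/-- A *generalized root system* on a semi-Cartan graph. -/
structure GRS (G : SCG θ X) : Type where
  /-- the root sets `Δ^x` -/
  Δ : X → Set (Fin θ → ℤ)
  pos_neg : ∀ x, Δ x = (Δ x ∩ {v | ∀ k, 0 ≤ v k}) ∪ (-(Δ x ∩ {v | ∀ k, 0 ≤ v k}))
  simple : ∀ x i, Δ x ∩ {v | ∃ c : ℤ, v = c • al θ i} = {al θ i, -al θ i}
  reflect : ∀ x i, (srefl G x i) '' Δ x = Δ (G.ρ i x)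
  pairFinite : ∀ x i j, (Δ x ∩ pairCone θ i j).Finite
  loop : ∀ x i j, (fun y => G.ρ i (G.ρ j y))^[(Δ x ∩ pairCone θ i j).ncard] x = x

variable (G : SCG θ X)

/-- The entries `m^x_{ij} = |Δ^x ∩ (ℕ₀α_i + ℕ₀α_j)|`. -/
def mnum (R : GRS G) (x : X) (i j : Fin θ) : ℕ := (R.Δ x ∩ pairCone θ i j).ncard

/-- the set of positive roots `Δ^x_+` -/
def posRoots (R : GRS G) (x : X) : Set (Fin θ → ℤ) := R.Δ x ∩ {v | ∀ k, 0 ≤ v k}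

/-- The objects of the Weyl groupoid (a type synonym for `X` carrying a quiver
structure depending on `G`). -/
def Obj (G : SCG θ X) : Type := X

instance : Quiver (Obj G) := ⟨fun a b => {i : Fin θ // G.ρ i (show X from b) = (show X from a)}⟩

/-- objects of the path category -/
def pob (x : X) : Paths (Obj G) := (x : X)

/-- the generating arrow `σ_i^x : ρ_i(x) → x` -/
def genArrow (x : X) (i : Fin θ) : pob G (G.ρ i x) ⟶ pob G x :=
  Quiver.Path.nil.cons (⟨i, rfl⟩ : (show Obj G from G.ρ i x) ⟶ (show Obj G from x))

/-- the source of the word `σ_{i_1}^x σ_{i_2} ⋯ σ_{i_m}` (with target `x`) -/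
def wsrc (G : SCG θ X) : List (Fin θ) → X → X
  | [], x => x
  | i :: l, x => wsrc G l (G.ρ i x)

/-- the path `σ_{i_1}^x σ_{i_2} ⋯ σ_{i_m} : wsrc(w,x) → x` in the free category -/
def pathOf (G : SCG θ X) : (w : List (Fin θ)) → (x : X) → (pob G (wsrc G w x) ⟶ pob G x)
  | [], _ => 𝟙 _
  | i :: l, x => (pathOf G l (G.ρ i x)) ≫ genArrow G x i


/-- transport a path along an equality of sources -/
def castSrc {a b c : X} (h : a = b) (f : pob G a ⟶ pob G c) : pob G b ⟶ pob G c := by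
  subst h; exact f

/-- the alternating word `[i, j, i, j, …]` of length `n` -/
def altWord (i j : Fin θ) : ℕ → List (Fin θ)
  | 0 => []
  | n + 1 => i :: altWord j i n

/-- The defining relations `(σ_i^x σ_j)^{m^x_{ij}} = id_x` of the Weyl groupoid. -/
inductive wrel (R : GRS G) : HomRel (Paths (Obj G))
  | rel (x : X) (i j : Fin θ)
      (h : wsrc G (altWord i j (2 * mnum G R x i j)) x = x) :
      wrel R (castSrc G h (pathOf G (altWord i j (2 * mnum G R x i j)) x))
        (𝟙 (pob G x))

variable (R : GRS G)

/-- The Weyl groupoid, as the quotient of the free category on the quiver of the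
`σ_i^x` by the relations `(σ_i^x σ_j)^{m^x_{ij}} = id_x` (every generator is invertible
in this quotient, so it is indeed a groupoid). -/
def W := CategoryTheory.Quotient (wrel G R)

instance : Category (W G R) := inferInstanceAs (Category (CategoryTheory.Quotient (wrel G R)))

/-- objects of the Weyl groupoid -/
def objW (x : X) : W G R := ⟨pob G x⟩

/-- hom-sets `𝒲(y, x)` of the Weyl groupoid -/
def homW (y x : X) := objW G R y ⟶ objW G R x

instance {y x : X} : CoeSort (homW G R y x) (objW G R y ⟶ objW G R x) := ⟨id⟩

/-- the morphism of the Weyl groupoid defined by the word `σ_{i_1}^x ⋯ σ_{i_m}` -/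
def morW (w : List (Fin θ)) (x : X) : homW G R (wsrc G w x) x :=
  (Quotient.functor (wrel G R)).map (pathOf G w x)

/-- the generator `σ_i^x : ρ_i(x) → x` in the Weyl groupoid -/
def genW (x : X) (i : Fin θ) : homW G R (G.ρ i x) x :=
  (Quotient.functor (wrel G R)).map (genArrow G x i)

/-- transport a morphism of the Weyl groupoid along an equality of sources -/
def castW {a b c : X} (h : a = b) (f : homW G R a c) : homW G R b c := by
  subst h; exact f

/-- transport a morphism of the Weyl groupoid along an equality of targets -/
def castTgt {a c c' : X} (h : c = c') (f : homW G R a c) : homW G R a c' := by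
  subst h; exact f

/-- the length `ℓ(f)` of a morphism of the Weyl groupoid -/
def len {y x : X} (f : homW G R y x) : ℕ :=
  sInf {n | ∃ w : List (Fin θ), w.length = n ∧
    ∃ h : wsrc G w x = y, castW G R h (morW G R w x) = f}

/-- `w` is a reduced expression of the morphism `f ∈ 𝒲(y,x)` -/
def IsRedEx (w : List (Fin θ)) {y x : X} (f : homW G R y x) : Prop :=
  ∃ h : wsrc G w x = y, castW G R h (morW G R w x) = f ∧ w.length = len G R f


section NilHecke

variable (𝕂 : Type) [CommRing 𝕂]

/-- the generator `e^x` of the free algebra -/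
def eF (x : X) : FreeAlgebra 𝕂 (X ⊕ X × Fin θ) := FreeAlgebra.ι 𝕂 (Sum.inl x)

/-- the generator `n_i^x` of the free algebra -/
def nF (x : X) (i : Fin θ) : FreeAlgebra 𝕂 (X ⊕ X × Fin θ) := FreeAlgebra.ι 𝕂 (Sum.inr (x, i))

/-- the word `n_{i_1}^x n_{i_2} ⋯ n_{i_m}` in the free algebra
(superscripts determined by composability) -/
def nWF (G : SCG θ X) (𝕂 : Type) [CommRing 𝕂] :
    List (Fin θ) → X → FreeAlgebra 𝕂 (X ⊕ X × Fin θ)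
  | [], _ => 1
  | i :: l, x => nF 𝕂 x i * nWF G 𝕂 l (G.ρ i x)

/-- The defining relations of the nil-Hecke algebra of `(X, ρ, 𝒞)`. -/
inductive nrel (R : GRS G) (𝕂 : Type) [CommRing 𝕂] :
    FreeAlgebra 𝕂 (X ⊕ X × Fin θ) → FreeAlgebra 𝕂 (X ⊕ X × Fin θ) → Prop
  | orth (x y : X) (h : x ≠ y) : nrel R 𝕂 (eF 𝕂 x * eF 𝕂 y) 0
  | idem (x : X) : nrel R 𝕂 (eF 𝕂 x * eF 𝕂 x) (eF 𝕂 x)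
  | total : nrel R 𝕂 (∑ x : X, eF 𝕂 x) 1
  | unit_right (x : X) (i : Fin θ) : nrel R 𝕂 (nF 𝕂 x i * eF 𝕂 (G.ρ i x)) (nF 𝕂 x i)
  | unit_left (x : X) (i : Fin θ) : nrel R 𝕂 (eF 𝕂 x * nF 𝕂 x i) (nF 𝕂 x i)
  | nil (x : X) (i : Fin θ) : nrel R 𝕂 (nF 𝕂 (G.ρ i x) i * nF 𝕂 x i) 0
  | braid (x : X) (i j : Fin θ) (hij : i ≠ j) :
      nrel R 𝕂 (nWF G 𝕂 (altWord i j (mnum G R x i j)) x)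
        (nWF G 𝕂 (altWord j i (mnum G R x i j)) x)

/-- The nil-Hecke algebra `𝒩(X, ρ, 𝒞)` of a Weyl groupoid over `𝕂`. -/
def NH := RingQuot (nrel G R 𝕂)

instance : Ring (NH G R 𝕂) := inferInstanceAs (Ring (RingQuot (nrel G R 𝕂)))
instance : Algebra 𝕂 (NH G R 𝕂) := inferInstanceAs (Algebra 𝕂 (RingQuot (nrel G R 𝕂)))

/-- the generator `e^x` of the nil-Hecke algebra -/
def eN (x : X) : NH G R 𝕂 := RingQuot.mkAlgHom 𝕂 (nrel G R 𝕂) (eF 𝕂 x)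

/-- the generator `n_i^x` of the nil-Hecke algebra -/
def nN (x : X) (i : Fin θ) : NH G R 𝕂 := RingQuot.mkAlgHom 𝕂 (nrel G R 𝕂) (nF 𝕂 x i)

/-- the word `n_{i_1}^x n_{i_2} ⋯ n_{i_m}` in the nil-Hecke algebra -/
def nW (w : List (Fin θ)) (x : X) : NH G R 𝕂 := RingQuot.mkAlgHom 𝕂 (nrel G R 𝕂) (nWF G 𝕂 w x)

/-- the set of morphisms of the Weyl groupoid -/
def Mor := Σ (y : X) (x : X), homW G R y x

/-- the free `𝕂`-module `𝕂𝒲` on the set of morphisms of the Weyl groupoid -/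
abbrev KW := Mor G R →₀ 𝕂

/-- the endomorphism `E^x` of `𝕂𝒲` -/
def Emap (x : X) : KW G R 𝕂 →ₗ[𝕂] KW G R 𝕂 :=
  Finsupp.lift (KW G R 𝕂) 𝕂 (Mor G R)
    (fun m => if m.2.1 = x then Finsupp.single m 1 else 0)

/-- the value of the endomorphism `L_i^x` of `𝕂𝒲` on a basis morphism -/
def Lval (x : X) (i : Fin θ) (m : Mor G R) : KW G R 𝕂 :=
  if h : m.2.1 = G.ρ i x then
    (let f' : homW G R m.1 x := castTgt G R h m.2.2 ≫ genW G R x i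
     if len G R m.2.2 < len G R f' then Finsupp.single ⟨m.1, x, f'⟩ 1 else 0)
  else 0

/-- the endomorphism `L_i^x` of `𝕂𝒲` -/
def Lmap (x : X) (i : Fin θ) : KW G R 𝕂 →ₗ[𝕂] KW G R 𝕂 :=
  Finsupp.lift (KW G R 𝕂) 𝕂 (Mor G R) (Lval G R 𝕂 x i)

end NilHecke

end WeylGroupoid

namespace WeylGroupoid

section RootCombinatorics

variable {θ : ℕ} {X : Type} [Fintype X] [DecidableEq X] {G : SCG θ X} (R : GRS G)

/-- the reflection `s_i^x` as a linear map -/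
def sreflL (G : SCG θ X) (x : X) (i : Fin θ) : (Fin θ → ℤ) →ₗ[ℤ] (Fin θ → ℤ) where
  toFun := srefl G x i
  map_add' v w := by
    funext k
    by_cases h : k = i <;> simp [srefl, h, mul_add, Finset.sum_add_distrib]
    ring
  map_smul' c v := by
    funext k
    by_cases h : k = i <;> simp [srefl, h, mul_sub, Finset.mul_sum, mul_left_comm]

theorem sreflL_apply_of_ne (x : X) {i k : Fin θ} (h : k ≠ i) (v : Fin θ → ℤ) :
    sreflL G x i v k = v k := by
  simp [sreflL, srefl, h]

theorem sreflL_al (x : X) (i j : Fin θ) :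
    sreflL G x i (al θ j) = al θ j - G.C x i j • al θ i := by
  funext k
  by_cases h : k = i <;> simp [sreflL, srefl, al, h, Pi.single_apply]

theorem sreflL_al_self (x : X) (i : Fin θ) : sreflL G x i (al θ i) = -al θ i := by
  rw [sreflL_al, G.diag]
  module

theorem sreflL_rho (x : X) (i : Fin θ) : sreflL G (G.ρ i x) i = sreflL G x i := by
  ext v k
  simp [sreflL, srefl, G.compat]

theorem sreflL_apply (x : X) (i : Fin θ) (v : Fin θ → ℤ) :
    sreflL G x i v = v - (∑ j, G.C x i j * v j) • al θ i := by
  funext k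
  by_cases h : k = i <;> simp [sreflL, srefl, al, h]

theorem sreflL_sreflL (x : X) (i : Fin θ) (v : Fin θ → ℤ) :
    sreflL G x i (sreflL G x i v) = v := by
  rw [sreflL_apply x i v, map_sub, map_smul, sreflL_al_self, sreflL_apply x i v]
  module

theorem sreflL_mem {x : X} {v : Fin θ → ℤ} (i : Fin θ) (hv : v ∈ R.Δ x) :
    sreflL G x i v ∈ R.Δ (G.ρ i x) := by
  rw [← R.reflect x i]
  exact ⟨v, hv, rfl⟩

theorem al_nonneg (i : Fin θ) : 0 ≤ al θ i := by
  intro k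
  by_cases h : k = i <;> simp [al, h]

theorem al_ne_zero (i : Fin θ) : al θ i ≠ 0 := by
  intro h
  simpa [al] using congrFun h i

theorem al_mem (x : X) (i : Fin θ) : al θ i ∈ R.Δ x := by
  have h : al θ i ∈ R.Δ x ∩ {v | ∃ c : ℤ, v = c • al θ i} := by
    rw [R.simple]
    simp
  exact h.1

theorem nonneg_or_nonpos {x : X} {v : Fin θ → ℤ} (hv : v ∈ R.Δ x) : 0 ≤ v ∨ v ≤ 0 := by
  rw [R.pos_neg x] at hv
  rcases hv with hv | hv
  · exact Or.inl hv.2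
  · right
    intro k
    have := hv.2 k
    simpa using this

theorem ne_zero_of_mem {x : X} (i : Fin θ) {v : Fin θ → ℤ} (hv : v ∈ R.Δ x) : v ≠ 0 := by
  rintro rfl
  have h : (0 : Fin θ → ℤ) ∈ R.Δ x ∩ {v | ∃ c : ℤ, v = c • al θ i} := ⟨hv, 0, by simp⟩
  rw [R.simple] at h
  rcases h with h | h
  · exact al_ne_zero i h.symm
  · exact al_ne_zero i (neg_eq_zero.mp h.symm)

theorem exists_pos_coeff {x : X} {i : Fin θ} {v : Fin θ → ℤ} (hv : v ∈ R.Δ x) (h0 : 0 ≤ v)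
    (hne : v ≠ al θ i) : ∃ k, k ≠ i ∧ 0 < v k := by
  by_contra! hcon
  have hz : ∀ k, k ≠ i → v k = 0 := fun k hk => le_antisymm (hcon k hk) (h0 k)
  have h : v ∈ R.Δ x ∩ {v | ∃ c : ℤ, v = c • al θ i} := by
    refine ⟨hv, v i, ?_⟩
    funext k
    by_cases hk : k = i
    · subst hk; simp [al]
    · simp [al, hk, hz k hk]
  rw [R.simple] at h
  rcases h with h | h
  · exact hne h
  · have := h0 i
    rw [h] at this
    simp [al] at this

theorem sreflL_nonneg {x : X} {i : Fin θ} {v : Fin θ → ℤ} (hv : v ∈ R.Δ x) (h0 : 0 ≤ v)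
    (hne : v ≠ al θ i) : 0 ≤ sreflL G x i v := by
  obtain ⟨k, hk, hpos⟩ := exists_pos_coeff R hv h0 hne
  rcases nonneg_or_nonpos R (sreflL_mem R i hv) with h | h
  · exact h
  · have := h k
    rw [sreflL_apply_of_ne x hk] at this
    exact absurd this (not_le.mpr hpos)

/-- the linear map `s_{i_m} ⋯ s_{i_1}` from the lattice at `x` to the lattice at the source of
the word `σ_{i_1}^x ⋯ σ_{i_m}` -/
def act (G : SCG θ X) : List (Fin θ) → X → ((Fin θ → ℤ) →ₗ[ℤ] (Fin θ → ℤ))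
  | [], _ => LinearMap.id
  | i :: l, x => act G l (G.ρ i x) ∘ₗ sreflL G x i

theorem wsrc_append (a b : List (Fin θ)) (x : X) :
    wsrc G (a ++ b) x = wsrc G b (wsrc G a x) := by
  induction a generalizing x with
  | nil => rfl
  | cons i a ih => exact ih _

theorem act_append (a b : List (Fin θ)) (x : X) :
    act G (a ++ b) x = act G b (wsrc G a x) ∘ₗ act G a x := by
  induction a generalizing x with
  | nil => rfl
  | cons i a ih =>
    change act G (a ++ b) (G.ρ i x) ∘ₗ _ = _
    rw [ih]
    rfl

theorem act_mem (a : List (Fin θ)) {x : X} {v : Fin θ → ℤ} (hv : v ∈ R.Δ x) :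
    act G a x v ∈ R.Δ (wsrc G a x) := by
  induction a generalizing x v with
  | nil => exact hv
  | cons i a ih => exact ih (sreflL_mem R i hv)

theorem act_cons_al_self (a : List (Fin θ)) (x : X) (i : Fin θ) :
    act G (i :: a) x (al θ i) = -act G a (G.ρ i x) (al θ i) := by
  change act G a (G.ρ i x) (sreflL G x i (al θ i)) = _
  rw [sreflL_al_self, map_neg]

theorem wsrc_reverse (a : List (Fin θ)) (x : X) : wsrc G a.reverse (wsrc G a x) = x := by
  induction a generalizing x with
  | nil => rfl
  | cons i a ih =>
    rw [List.reverse_cons, wsrc_append]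
    change wsrc G [i] (wsrc G a.reverse (wsrc G a (G.ρ i x))) = x
    rw [ih]
    exact G.invol i x

theorem act_reverse (a : List (Fin θ)) (x : X) (v : Fin θ → ℤ) :
    act G a.reverse (wsrc G a x) (act G a x v) = v := by
  induction a generalizing x v with
  | nil => rfl
  | cons i a ih =>
    rw [List.reverse_cons, act_append]
    change act G [i] (wsrc G a.reverse (wsrc G a (G.ρ i x)))
      (act G a.reverse (wsrc G a (G.ρ i x)) (act G a (G.ρ i x) (sreflL G x i v))) = v
    rw [ih, wsrc_reverse]
    change sreflL G (G.ρ i x) i (sreflL G x i v) = v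
    rw [sreflL_rho, sreflL_sreflL]

/-- the positive roots made negative by a word -/
def invSet (a : List (Fin θ)) (x : X) : Set (Fin θ → ℤ) :=
  {v | v ∈ R.Δ x ∧ 0 ≤ v ∧ act G a x v ≤ 0}

theorem invSet_finite_ncard_le (i₀ : Fin θ) (a : List (Fin θ)) (x : X) :
    (invSet R a x).Finite ∧ (invSet R a x).ncard ≤ a.length := by
  induction a generalizing x with
  | nil =>
    have : invSet R [] x ⊆ ∅ := by
      rintro v ⟨hv, h0, h1⟩
      exact ne_zero_of_mem R i₀ hv (le_antisymm h1 h0)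
    rw [Set.subset_empty_iff.mp this]
    simp
  | cons i a ih =>
    obtain ⟨hfin, hcard⟩ := ih (G.ρ i x)
    have hsub : invSet R (i :: a) x ⊆ insert (al θ i) (sreflL G x i '' invSet R a (G.ρ i x)) := by
      rintro v ⟨hv, h0, h1⟩
      by_cases h : v = al θ i
      · exact Or.inl h
      · exact Or.inr ⟨sreflL G x i v, ⟨sreflL_mem R i hv, sreflL_nonneg R hv h0 h, h1⟩,
          sreflL_sreflL x i v⟩
    have hfin' := (hfin.image (sreflL G x i)).insert (al θ i)
    refine ⟨hfin'.subset hsub, (Set.ncard_le_ncard hsub hfin').trans ?_⟩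
    refine (Set.ncard_insert_le _ _).trans ?_
    have := Set.ncard_image_le (f := sreflL G x i) hfin
    simp only [List.length_cons]
    lia

theorem mem_pairCone {i j : Fin θ} (hij : i ≠ j) {v : Fin θ → ℤ} :
    v ∈ pairCone θ i j ↔ 0 ≤ v ∧ ∀ k, k ≠ i → k ≠ j → v k = 0 := by
  constructor
  · rintro ⟨a, b, rfl⟩
    refine ⟨?_, fun k hi hj => by simp [al, hi, hj]⟩
    exact add_nonneg (smul_nonneg (by positivity) (al_nonneg i))
      (smul_nonneg (by positivity) (al_nonneg j))
  · rintro ⟨h0, hz⟩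
    refine ⟨(v i).toNat, (v j).toNat, ?_⟩
    rw [Int.toNat_of_nonneg (h0 i), Int.toNat_of_nonneg (h0 j)]
    funext k
    by_cases hi : k = i
    · subst hi; simp [al, hij]
    · by_cases hj : k = j
      · subst hj; simp [al, hi]
      · simp [al, hi, hj, hz k hi hj]

theorem pairCone_comm (i j : Fin θ) : pairCone θ i j = pairCone θ j i := by
  ext v
  constructor <;> rintro ⟨a, b, rfl⟩ <;> exact ⟨b, a, add_comm _ _⟩

theorem mnum_comm (x : X) (i j : Fin θ) : mnum G R x i j = mnum G R x j i := by
  rw [mnum, mnum, pairCone_comm]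

theorem al_mem_pairCone (i j : Fin θ) : al θ i ∈ pairCone θ i j := ⟨1, 0, by simp⟩

theorem al_mem_pairCone' (i j : Fin θ) : al θ j ∈ pairCone θ i j := ⟨0, 1, by simp⟩

theorem mnum_pos (x : X) (i j : Fin θ) : 0 < mnum G R x i j :=
  (Set.ncard_pos (R.pairFinite x i j)).mpr ⟨al θ i, al_mem R x i, al_mem_pairCone i j⟩

theorem sreflL_mem_pairCone {i j : Fin θ} (hij : i ≠ j) {x : X} {v : Fin θ → ℤ}
    (hv : v ∈ R.Δ x ∩ pairCone θ i j) (hne : v ≠ al θ i) :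
    sreflL G x i v ∈ R.Δ (G.ρ i x) ∩ pairCone θ i j := by
  obtain ⟨h0, hz⟩ := (mem_pairCone hij).mp hv.2
  refine ⟨sreflL_mem R i hv.1, (mem_pairCone hij).mpr ⟨sreflL_nonneg R hv.1 h0 hne, ?_⟩⟩
  intro k hi hj
  rw [sreflL_apply_of_ne x hi, hz k hi hj]

theorem sreflL_ne_al {x : X} {i : Fin θ} {v : Fin θ → ℤ} (h0 : 0 ≤ v) :
    sreflL G x i v ≠ al θ i := by
  intro h
  have h1 := congrArg (sreflL G x i) h
  rw [sreflL_sreflL, sreflL_al_self] at h1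
  have h2 := h0 i
  rw [h1] at h2
  simp [al] at h2

theorem mnum_le_mnum_rho {i j : Fin θ} (hij : i ≠ j) (x : X) :
    mnum G R x i j ≤ mnum G R (G.ρ i x) i j := by
  refine Set.ncard_le_ncard_of_injOn
    (fun v => if v = al θ i then al θ i else sreflL G x i v) ?_ ?_ (R.pairFinite _ i j)
  · intro v hv
    by_cases h : v = al θ i
    · simpa [h] using ⟨al_mem R _ i, al_mem_pairCone i j⟩
    · simpa [h] using sreflL_mem_pairCone R hij hv h
  · intro v hv w hw hvw
    have hv0 := ((mem_pairCone hij).mp hv.2).1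
    have hw0 := ((mem_pairCone hij).mp hw.2).1
    by_cases h : v = al θ i <;> by_cases h' : w = al θ i <;>
      simp only [h, h', if_true, if_false] at hvw ⊢
    · exact absurd hvw.symm (sreflL_ne_al hw0)
    · exact absurd hvw (sreflL_ne_al hv0)
    · have := congrArg (sreflL G x i) hvw
      rwa [sreflL_sreflL, sreflL_sreflL] at this

theorem mnum_rho {i j : Fin θ} (hij : i ≠ j) (x : X) :
    mnum G R (G.ρ i x) i j = mnum G R x i j := by
  refine le_antisymm ?_ (mnum_le_mnum_rho R hij x)
  have := mnum_le_mnum_rho R hij (G.ρ i x)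
  rwa [G.invol] at this

theorem mnum_wsrc_altWord {i j : Fin θ} (hij : i ≠ j) (n : ℕ) (x : X) :
    mnum G R (wsrc G (altWord i j n) x) i j = mnum G R x i j := by
  induction n generalizing i j x with
  | zero => rfl
  | succ n ih =>
    change mnum G R (wsrc G (altWord j i n) (G.ρ i x)) i j = _
    rw [mnum_comm, ih hij.symm, mnum_comm, mnum_rho R hij]

theorem act_altWord_apply (i j : Fin θ) (n : ℕ) (x : X) (v : Fin θ → ℤ) {k : Fin θ}
    (hi : k ≠ i) (hj : k ≠ j) : act G (altWord i j n) x v k = v k := by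
  induction n generalizing i j x v with
  | zero => rfl
  | succ n ih =>
    change act G (altWord j i n) (G.ρ i x) (sreflL G x i v) k = _
    rw [ih j i _ _ hj hi, sreflL_apply_of_ne x hi]

theorem length_altWord (i j : Fin θ) (n : ℕ) : (altWord i j n).length = n := by
  induction n generalizing i j with
  | zero => rfl
  | succ n ih => simp [altWord, ih]

theorem map_pairCone_nonneg {i j : Fin θ} (f : (Fin θ → ℤ) →ₗ[ℤ] (Fin θ → ℤ))
    (hi : 0 ≤ f (al θ i)) (hj : 0 ≤ f (al θ j)) {v : Fin θ → ℤ} (hv : v ∈ pairCone θ i j) :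
    0 ≤ f v := by
  obtain ⟨a, b, rfl⟩ := hv
  rw [map_add, map_smul, map_smul]
  exact add_nonneg (smul_nonneg (by positivity) hi) (smul_nonneg (by positivity) hj)

theorem map_pairCone_nonpos {i j : Fin θ} (f : (Fin θ → ℤ) →ₗ[ℤ] (Fin θ → ℤ))
    (hi : f (al θ i) ≤ 0) (hj : f (al θ j) ≤ 0) {v : Fin θ → ℤ} (hv : v ∈ pairCone θ i j) :
    f v ≤ 0 := by
  have := map_pairCone_nonneg (-f) (by simpa using hi) (by simpa using hj) hv
  simpa using this

theorem act_altWord_al_nonneg {i j : Fin θ} (hij : i ≠ j) {n : ℕ} {x : X}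
    (hn : n < mnum G R x i j) : 0 ≤ act G (altWord j i n) x (al θ i) := by
  induction n generalizing i j x with
  | zero => exact al_nonneg i
  | succ n ih =>
    rcases nonneg_or_nonpos R (act_mem R (altWord j i (n + 1)) (al_mem R x i)) with h | hi
    · exact h
    · exfalso
      have hj : act G (altWord j i (n + 1)) x (al θ j) ≤ 0 := by
        change act G (j :: altWord i j n) x (al θ j) ≤ 0
        rw [act_cons_al_self, neg_nonpos]
        apply ih hij.symm
        rw [mnum_rho R hij.symm, mnum_comm]
        lia
      obtain ⟨hfin, hcard⟩ := invSet_finite_ncard_le R i (altWord j i (n + 1)) x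
      have hsub : R.Δ x ∩ pairCone θ i j ⊆ invSet R (altWord j i (n + 1)) x := fun v hv =>
        ⟨hv.1, ((mem_pairCone hij).mp hv.2).1, map_pairCone_nonpos _ hi hj hv.2⟩
      have := Set.ncard_le_ncard hsub hfin
      rw [length_altWord] at hcard
      rw [mnum] at hn
      lia

theorem act_altWord_al_mem_pairCone {i j : Fin θ} (hij : i ≠ j) {n : ℕ} {x : X}
    (hn : n < mnum G R x i j) : act G (altWord j i n) x (al θ i) ∈ pairCone θ i j := by
  refine (mem_pairCone hij).mpr ⟨act_altWord_al_nonneg R hij hn, fun k hi hj => ?_⟩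
  rw [act_altWord_apply j i n x _ hj hi]
  simp [al, hi]

theorem le_ncard_invSet_altWord {i j : Fin θ} (hij : i ≠ j) {n : ℕ} {x : X}
    (hn : n ≤ mnum G R x i j) :
    n ≤ (invSet R (altWord i j n) x ∩ pairCone θ i j).ncard := by
  induction n generalizing i j x with
  | zero => exact Nat.zero_le _
  | succ n ih =>
    have hm : mnum G R (G.ρ i x) i j = mnum G R x i j := mnum_rho R hij x
    have hpos : 0 ≤ act G (altWord j i n) (G.ρ i x) (al θ i) :=
      act_altWord_al_nonneg R hij (by lia)
    have hle := ih (i := j) (j := i) hij.symm (x := G.ρ i x) (by rw [mnum_comm]; lia)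
    rw [pairCone_comm] at hle
    set S := invSet R (altWord j i n) (G.ρ i x) ∩ pairCone θ i j with hS
    have hfin : S.Finite := ((R.pairFinite (G.ρ i x) i j).subset fun v hv => ⟨hv.1.1, hv.2⟩)
    have hnot : al θ i ∉ sreflL G x i '' S := by
      rintro ⟨v, hv, h⟩
      exact sreflL_ne_al hv.1.2.1 h
    have hinj : Function.Injective (sreflL G x i) :=
      Function.LeftInverse.injective (sreflL_sreflL x i)
    have hsub : insert (al θ i) (sreflL G x i '' S) ⊆
        invSet R (altWord i j (n + 1)) x ∩ pairCone θ i j := by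
      apply Set.insert_subset
      · refine ⟨⟨al_mem R x i, al_nonneg i, ?_⟩, al_mem_pairCone i j⟩
        change act G (i :: altWord j i n) x (al θ i) ≤ 0
        rw [act_cons_al_self]
        exact neg_nonpos.mpr hpos
      · rintro _ ⟨v, hv, rfl⟩
        have hne : v ≠ al θ i := by
          rintro rfl
          exact ne_zero_of_mem R i (act_mem R (altWord j i n) hv.1.1)
            (le_antisymm hv.1.2.2 hpos)
        have h1 := sreflL_mem_pairCone R hij ⟨hv.1.1, hv.2⟩ hne
        rw [sreflL_rho, G.invol] at h1
        refine ⟨⟨h1.1, ((mem_pairCone hij).mp h1.2).1, ?_⟩, h1.2⟩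
        change act G (altWord j i n) (G.ρ i x) (sreflL G x i (sreflL G x i v)) ≤ 0
        rw [sreflL_sreflL]
        exact hv.1.2.2
    have hfin' : (invSet R (altWord i j (n + 1)) x ∩ pairCone θ i j).Finite :=
      (R.pairFinite x i j).subset fun v hv => ⟨hv.1.1, hv.2⟩
    have := Set.ncard_le_ncard hsub hfin'
    rw [Set.ncard_insert_of_notMem hnot (hfin.image _), Set.ncard_image_of_injective _ hinj] at this
    lia

theorem act_altWord_mnum_nonpos {i j : Fin θ} (hij : i ≠ j) (x : X) :
    act G (altWord i j (mnum G R x i j)) x (al θ j) ≤ 0 := by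
  have h := Set.eq_of_subset_of_ncard_le
    (s := invSet R (altWord i j (mnum G R x i j)) x ∩ pairCone θ i j)
    (t := R.Δ x ∩ pairCone θ i j) (fun v hv => ⟨hv.1.1, hv.2⟩)
    (le_ncard_invSet_altWord R hij le_rfl) (R.pairFinite x i j)
  have hj : al θ j ∈ R.Δ x ∩ pairCone θ i j := ⟨al_mem R x j, al_mem_pairCone' i j⟩
  rw [← h] at hj
  exact hj.1.2.2

/-- the letter at position `n` of the alternating sequence `i, j, i, j, …` -/
def altLetter (i j : Fin θ) : ℕ → Fin θ
  | 0 => i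
  | n + 1 => altLetter j i n

theorem altWord_add (i j : Fin θ) (a b : ℕ) :
    altWord i j (a + b) = altWord i j a ++ altWord (altLetter i j a) (altLetter j i a) b := by
  induction a generalizing i j with
  | zero => simp [altWord, altLetter]
  | succ a ih =>
    rw [Nat.add_right_comm]
    exact congrArg (i :: ·) (ih j i)

theorem altLetter_add (i j : Fin θ) (a b : ℕ) :
    altLetter (altLetter i j a) (altLetter j i a) b = altLetter i j (a + b) := by
  induction a generalizing i j with
  | zero => simp [altLetter]
  | succ a ih =>
    rw [Nat.add_right_comm]
    exact ih j i

theorem altLetter_add_self (i j : Fin θ) (n : ℕ) : altLetter i j (n + n) = i := by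
  induction n with
  | zero => rfl
  | succ n ih =>
    rw [show n + 1 + (n + 1) = n + n + 1 + 1 by ring]
    exact ih

theorem altLetter_cases (i j : Fin θ) (n : ℕ) :
    (altLetter i j n = i ∧ altLetter j i n = j) ∨ (altLetter i j n = j ∧ altLetter j i n = i) := by
  induction n with
  | zero => exact Or.inl ⟨rfl, rfl⟩
  | succ n ih => exact ih.symm.imp And.symm And.symm

theorem reverse_altWord (i j : Fin θ) (n : ℕ) :
    (altWord i j n).reverse = altWord (altLetter j i n) (altLetter i j n) n := by
  induction n generalizing i j with
  | zero => rfl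
  | succ n ih =>
    change (i :: altWord j i n).reverse = altWord (altLetter i j n) (altLetter j i n) (n + 1)
    rw [List.reverse_cons, ih, altWord_add, altLetter_add, altLetter_add_self]
    rfl

theorem act_altWord_mnum_al {i j : Fin θ} (hij : i ≠ j) (x : X) :
    act G (altWord i j (mnum G R x i j)) x (al θ j) =
      -al θ (altLetter j i (mnum G R x i j)) := by
  have hneg := act_altWord_mnum_nonpos R hij x
  obtain ⟨n, hn⟩ := Nat.exists_eq_succ_of_ne_zero (mnum_pos R x i j).ne'
  have hpos : 0 ≤ act G (altWord i j n) x (al θ j) :=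
    act_altWord_al_nonneg R hij.symm (by rw [mnum_comm]; lia)
  rw [hn, Nat.succ_eq_add_one, altWord_add, act_append] at hneg ⊢
  change sreflL G _ (altLetter i j n) (act G (altWord i j n) x (al θ j)) ≤ 0 at hneg
  change sreflL G _ (altLetter i j n) (act G (altWord i j n) x (al θ j)) = -al θ (altLetter i j n)
  have hmem := act_mem R (altWord i j n) (al_mem R x j)
  have heq : act G (altWord i j n) x (al θ j) = al θ (altLetter i j n) := by
    by_contra hne
    exact ne_zero_of_mem R i (sreflL_mem R (altLetter i j n) hmem)
      (le_antisymm hneg (sreflL_nonneg R hmem hpos hne))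
  rw [heq, sreflL_al_self]

theorem altLetter_ne {i j : Fin θ} (hij : i ≠ j) (n : ℕ) : altLetter i j n ≠ altLetter j i n := by
  rcases altLetter_cases i j n with ⟨h, h'⟩ | ⟨h, h'⟩ <;> rw [h, h']
  exacts [hij, hij.symm]

theorem mnum_altLetter (x : X) (i j : Fin θ) (n : ℕ) :
    mnum G R x (altLetter i j n) (altLetter j i n) = mnum G R x i j := by
  rcases altLetter_cases i j n with ⟨h, h'⟩ | ⟨h, h'⟩ <;> rw [h, h']
  exact mnum_comm R x j i

theorem act_altWord_two_mul_al {i j : Fin θ} (hij : i ≠ j) (x : X) :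
    act G (altWord i j (2 * mnum G R x i j)) x (al θ j) = al θ j := by
  have h1 := act_altWord_mnum_al R hij x
  have h2 := act_altWord_mnum_al R (altLetter_ne hij (mnum G R x i j))
    (wsrc G (altWord i j (mnum G R x i j)) x)
  rw [mnum_altLetter, mnum_wsrc_altWord R hij, altLetter_add, altLetter_add_self] at h2
  rw [two_mul, altWord_add, act_append, LinearMap.comp_apply, h1, map_neg, h2, neg_neg]

theorem wsrc_altWord_two_mul (i j : Fin θ) (n : ℕ) (x : X) :
    wsrc G (altWord i j (2 * n)) x = (fun y => G.ρ j (G.ρ i y))^[n] x := by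
  induction n generalizing x with
  | zero => rfl
  | succ n ih =>
    rw [Function.iterate_succ_apply, ← ih]
    rfl

theorem wsrc_altWord_two_mul_mnum (i j : Fin θ) (x : X) :
    wsrc G (altWord i j (2 * mnum G R x i j)) x = x := by
  rw [wsrc_altWord_two_mul, mnum_comm]
  exact R.loop x j i

theorem act_altWord_two_mul_comp (i j : Fin θ) (x : X) (v : Fin θ → ℤ) :
    act G (altWord j i (2 * mnum G R x i j)) x
      (act G (altWord i j (2 * mnum G R x i j)) x v) = v := by
  have h := act_reverse (G := G) (altWord i j (2 * mnum G R x i j)) x v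
  rwa [reverse_altWord, two_mul, altLetter_add_self, altLetter_add_self, ← two_mul,
    wsrc_altWord_two_mul_mnum] at h

theorem act_altWord_two_mul_al' {i j : Fin θ} (hij : i ≠ j) (x : X) :
    act G (altWord i j (2 * mnum G R x i j)) x (al θ i) = al θ i := by
  have h := act_altWord_two_mul_al R hij.symm x
  rw [mnum_comm] at h
  have h' := act_altWord_two_mul_comp R j i x (al θ i)
  rwa [mnum_comm, h] at h'

theorem act_altWord_two_mul_al_sub_mem {i j : Fin θ} (hij : i ≠ j) (x : X) {k : Fin θ}
    (hi : k ≠ i) (hj : k ≠ j) :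
    act G (altWord i j (2 * mnum G R x i j)) x (al θ k) - al θ k ∈ pairCone θ i j := by
  have hk := act_altWord_apply (G := G) i j (2 * mnum G R x i j) x (al θ k) hi hj
  refine (mem_pairCone hij).mpr ⟨?_, fun l hli hlj => ?_⟩
  · have h0 : 0 ≤ act G (altWord i j (2 * mnum G R x i j)) x (al θ k) := by
      rcases nonneg_or_nonpos R
        (act_mem R (altWord i j (2 * mnum G R x i j)) (al_mem R x k)) with h | h
      · exact h
      · have := h k
        rw [hk] at this
        simp [al] at this
    intro l
    by_cases hl : l = k
    · subst hl; simp [hk]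
    · simpa [al, hl] using h0 l
  · simp [act_altWord_apply i j (2 * mnum G R x i j) x (al θ k) hli hlj]

theorem act_altWord_two_mul (i j : Fin θ) (x : X) :
    act G (altWord i j (2 * mnum G R x i j)) x = LinearMap.id := by
  by_cases hij : i = j
  · subst hij
    have hm : ∀ n, act G (altWord i i (2 * n)) x = LinearMap.id := by
      intro n
      induction n with
      | zero => rfl
      | succ n ih =>
        have : altWord i i (2 * (n + 1)) = i :: i :: altWord i i (2 * n) := rfl
        rw [this]
        refine LinearMap.ext fun v => ?_
        change act G (altWord i i (2 * n)) (G.ρ i (G.ρ i x))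
          (sreflL G (G.ρ i x) i (sreflL G x i v)) = _
        rw [G.invol, sreflL_rho, sreflL_sreflL, ih]
    exact hm _
  · have key : ∀ k, act G (altWord i j (2 * mnum G R x i j)) x (al θ k) = al θ k := by
      intro k
      by_cases hi : k = i
      · subst hi; exact act_altWord_two_mul_al' R hij x
      by_cases hj : k = j
      · subst hj; exact act_altWord_two_mul_al R hij x
      set g := act G (altWord i j (2 * mnum G R x i j)) x with hg
      have h1 := act_altWord_two_mul_al_sub_mem R hij x hi hj
      rw [← hg] at h1
      have h2 := act_altWord_two_mul_al_sub_mem R (Ne.symm hij) x hj hi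
      have hcomp := act_altWord_two_mul_comp R i j x (al θ k)
      have h3 : act G (altWord j i (2 * mnum G R x i j)) x (g (al θ k) - al θ k) =
          g (al θ k) - al θ k := by
        obtain ⟨a, b, hab⟩ := h1
        have e1 := act_altWord_two_mul_al' R (Ne.symm hij) x
        have e2 := act_altWord_two_mul_al R (Ne.symm hij) x
        rw [mnum_comm] at e1 e2
        rw [hab, map_add, map_smul, map_smul, e1, e2]
      rw [map_sub, hcomp] at h3
      rw [mnum_comm] at h2
      have p1 := ((mem_pairCone hij).mp h1).1
      have p2 := ((mem_pairCone (Ne.symm hij)).mp h2).1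
      refine le_antisymm ?_ (sub_nonneg.mp p1)
      rw [← sub_nonpos, ← h3, ← neg_sub]
      exact neg_nonpos.mpr p2
    refine (Pi.basisFun ℤ (Fin θ)).ext fun k => ?_
    rw [Pi.basisFun_apply]
    exact key k

/-- the morphism of the Weyl groupoid defined by a word, bundled with its source -/
def wordMor (x : X) (a : List (Fin θ)) : Σ y : X, homW G R y x := ⟨wsrc G a x, morW G R a x⟩

/-- composition of a bundled morphism with the generator `σ_i^x` -/
def genPost (x : X) (i : Fin θ) (f : Σ y : X, homW G R y (G.ρ i x)) : Σ y : X, homW G R y x :=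
  ⟨f.1, CategoryStruct.comp (obj := W G R) f.2 (genW G R x i)⟩

/-- composition of a bundled morphism with a word at its source -/
def wordPre (x : X) (c : List (Fin θ)) (f : Σ y : X, homW G R y x) : Σ y : X, homW G R y x :=
  ⟨wsrc G c f.1, CategoryStruct.comp (obj := W G R) (morW G R c f.1) f.2⟩

theorem wordMor_cons (x : X) (i : Fin θ) (a : List (Fin θ)) :
    wordMor R x (i :: a) = genPost R x i (wordMor R (G.ρ i x) a) := by
  refine congrArg (Sigma.mk _) ?_
  exact (Quotient.functor (wrel G R)).map_comp (pathOf G a (G.ρ i x)) (genArrow G x i)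

theorem wordMor_nil (x : X) : wordMor R x [] = ⟨x, CategoryStruct.id (obj := W G R) _⟩ := by
  refine congrArg (Sigma.mk _) ?_
  exact (Quotient.functor (wrel G R)).map_id (pob G x)

theorem wordMor_append (x : X) (a c : List (Fin θ)) :
    wordMor R x (a ++ c) = wordPre R x c (wordMor R x a) := by
  induction a generalizing x with
  | nil =>
    rw [wordMor_nil]
    refine congrArg (Sigma.mk _) ?_
    exact (Category.comp_id (obj := W G R) (morW G R c x)).symm
  | cons i a ih =>
    rw [List.cons_append, wordMor_cons, wordMor_cons, ih]
    refine congrArg (Sigma.mk _) ?_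
    exact Category.assoc (obj := W G R) _ _ _

variable {R} in
theorem wordMor_cons_congr {x : X} (i : Fin θ) {a b : List (Fin θ)}
    (h : wordMor R (G.ρ i x) a = wordMor R (G.ρ i x) b) :
    wordMor R x (i :: a) = wordMor R x (i :: b) := by
  rw [wordMor_cons, wordMor_cons, h]

variable {R} in
theorem wordMor_append_congr_left {x : X} {a b : List (Fin θ)} (c : List (Fin θ))
    (h : wordMor R x a = wordMor R x b) : wordMor R x (a ++ c) = wordMor R x (b ++ c) := by
  rw [wordMor_append, wordMor_append, h]

variable {R} in
theorem wordMor_append_congr_right {x : X} (a : List (Fin θ)) {b c : List (Fin θ)}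
    (h : wordMor R (wsrc G a x) b = wordMor R (wsrc G a x) c) :
    wordMor R x (a ++ b) = wordMor R x (a ++ c) := by
  induction a generalizing x with
  | nil => exact h
  | cons i a ih => exact wordMor_cons_congr i (ih h)

theorem wordMor_altWord_two_mul (i j : Fin θ) (x : X) :
    wordMor R x (altWord i j (2 * mnum G R x i j)) = wordMor R x [] := by
  have hcast : ∀ {a b : X} (h : a = b) (f : pob G a ⟶ pob G x),
      (⟨a, (Quotient.functor (wrel G R)).map f⟩ : Σ y : X, homW G R y x) =
        ⟨b, (Quotient.functor (wrel G R)).map (castSrc G h f)⟩ := by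
    intro a b h f
    subst h
    rfl
  have h := wsrc_altWord_two_mul_mnum R i j x
  refine (hcast h _).trans (congrArg (Sigma.mk x) ?_)
  exact CategoryTheory.Quotient.sound _ (wrel.rel x i j h)

theorem mnum_self (x : X) (i : Fin θ) : mnum G R x i i = 1 := by
  rw [mnum, Set.ncard_eq_one]
  refine ⟨al θ i, Set.eq_singleton_iff_unique_mem.mpr
    ⟨⟨al_mem R x i, al_mem_pairCone i i⟩, ?_⟩⟩
  rintro v ⟨hv, a, b, rfl⟩
  have h : (a : ℤ) • al θ i + (b : ℤ) • al θ i ∈ R.Δ x ∩ {v | ∃ c : ℤ, v = c • al θ i} :=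
    ⟨hv, a + b, by module⟩
  rw [R.simple] at h
  rcases h with h | h
  · exact h
  · have := congrFun h i
    simp [al] at this
    lia

theorem wordMor_cons_cons (x : X) (i : Fin θ) (a : List (Fin θ)) :
    wordMor R x (i :: i :: a) = wordMor R x a := by
  have h := wordMor_altWord_two_mul R i i x
  rw [mnum_self] at h
  exact wordMor_append_congr_left a h

theorem wordMor_append_reverse (x : X) (a : List (Fin θ)) :
    wordMor R x (a ++ a.reverse) = wordMor R x [] := by
  induction a generalizing x with
  | nil => rfl
  | cons i a ih =>
    have h : i :: a ++ (i :: a).reverse = i :: ((a ++ a.reverse) ++ [i]) := by simp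
    rw [h, wordMor_cons_congr i (wordMor_append_congr_left [i] (ih _))]
    exact wordMor_cons_cons R x i []

theorem wordMor_braid (x : X) (i j : Fin θ) :
    wordMor R x (altWord i j (mnum G R x i j)) = wordMor R x (altWord j i (mnum G R x i j)) := by
  have h := wordMor_altWord_two_mul R i j x
  rw [two_mul, altWord_add, ← reverse_altWord] at h
  have h1 := wordMor_append_congr_left (altWord j i (mnum G R x i j)) h
  rw [List.append_assoc, List.nil_append] at h1
  rw [← h1]
  have h2 := wordMor_append_reverse R (wsrc G (altWord i j (mnum G R x i j)) x)
    (altWord j i (mnum G R x i j)).reverse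
  rw [List.reverse_reverse] at h2
  have h3 := wordMor_append_congr_right _ h2
  rw [List.append_nil] at h3
  exact h3.symm

/-- the linear realization of the path category, recorded contravariantly -/
def actFunctor (G : SCG θ X) :
    Paths (Obj G) ⥤ SingleObj (Module.End ℤ (Fin θ → ℤ))ᵐᵒᵖ :=
  Paths.lift
    { obj := fun _ => SingleObj.star _
      map := fun {_ b} i => MulOpposite.op (sreflL G (show X from b) i.1) }

theorem actFunctor_pathOf (a : List (Fin θ)) (x : X) :
    (actFunctor G).map (pathOf G a x) = MulOpposite.op (act G a x) := by
  induction a generalizing x with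
  | nil => exact (actFunctor G).map_id _
  | cons i a ih =>
    refine ((actFunctor G).map_comp (pathOf G a (G.ρ i x)) (genArrow G x i)).trans ?_
    rw [ih]
    have h : (actFunctor G).map (genArrow G x i) = MulOpposite.op (sreflL G x i) :=
      Category.id_comp (obj := SingleObj (Module.End ℤ (Fin θ → ℤ))ᵐᵒᵖ) _
    rw [h]
    rfl

theorem actFunctor_wrel {a b : Paths (Obj G)} (f g : a ⟶ b) (h : wrel G R f g) :
    (actFunctor G).map f = (actFunctor G).map g := by
  cases h with
  | rel x i j h =>
    have hcast : ∀ {a b : X} (h : a = b) (f : pob G a ⟶ pob G x),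
        (actFunctor G).map (castSrc G h f) = (actFunctor G).map f := by
      intro a b h f
      subst h
      rfl
    refine (hcast h _).trans ?_
    rw [actFunctor_pathOf, act_altWord_two_mul]
    exact ((actFunctor G).map_id _).symm

/-- the linear realization of the Weyl groupoid, recorded contravariantly -/
def actW : W G R ⥤ SingleObj (Module.End ℤ (Fin θ → ℤ))ᵐᵒᵖ :=
  CategoryTheory.Quotient.lift (wrel G R) (actFunctor G) fun _ _ f g h => actFunctor_wrel R f g h

variable {R} in
theorem act_eq_of_wordMor_eq {x : X} {a b : List (Fin θ)} (h : wordMor R x a = wordMor R x b) :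
    act G a x = act G b x := by
  have hmap : ∀ c, (actW R).map (wordMor R x c).2 = MulOpposite.op (act G c x) := fun c =>
    actFunctor_pathOf c x
  have key : ∀ f g : Σ y : X, homW G R y x, f = g →
      ((actW R).map f.2 : (Module.End ℤ (Fin θ → ℤ))ᵐᵒᵖ) = (actW R).map g.2 := by
    rintro f _ rfl
    rfl
  exact MulOpposite.op_injective ((hmap a).symm.trans ((key _ _ h).trans (hmap b)))

variable {R} in
theorem wsrc_eq_of_wordMor_eq {x : X} {a b : List (Fin θ)} (h : wordMor R x a = wordMor R x b) :
    wsrc G a x = wsrc G b x :=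
  congrArg Sigma.fst h

variable {R} in
theorem wordMor_cons_cancel {x : X} {i : Fin θ} {a b : List (Fin θ)}
    (h : wordMor R x (i :: a) = wordMor R x (i :: b)) :
    wordMor R (G.ρ i x) a = wordMor R (G.ρ i x) b := by
  rw [← wordMor_cons_cons R (G.ρ i x) i a, ← wordMor_cons_cons R (G.ρ i x) i b]
  apply wordMor_cons_congr
  rwa [G.invol]

/-- a word of minimal length among those defining the same morphism -/
def IsReduced (x : X) (a : List (Fin θ)) : Prop :=
  ∀ b, wordMor R x b = wordMor R x a → a.length ≤ b.length

/-- some word of the same length defining the same morphism starts with `i` -/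
def IsDescent (x : X) (a : List (Fin θ)) (i : Fin θ) : Prop :=
  ∃ b, wordMor R x (i :: b) = wordMor R x a ∧ b.length + 1 = a.length

variable {R}

theorem IsReduced.of_wordMor_eq {x : X} {a b : List (Fin θ)} (ha : IsReduced R x a)
    (h : wordMor R x b = wordMor R x a) (hl : b.length = a.length) : IsReduced R x b :=
  fun c hc => hl ▸ ha c (hc.trans h)

theorem IsReduced.of_append {x : X} {p v : List (Fin θ)} (h : IsReduced R x (p ++ v)) :
    IsReduced R (wsrc G p x) v := by
  intro b hb
  have := h (p ++ b) (wordMor_append_congr_right p hb)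
  simpa using this

theorem exists_altWord_or_repeat {i j : Fin θ} (p : List (Fin θ)) (hp : ∀ c ∈ p, c = i ∨ c = j) :
    (∃ n, p = altWord i j n) ∨ (∃ n, p = altWord j i n) ∨
      ∃ q c r, p = q ++ c :: c :: r := by
  induction p with
  | nil => exact Or.inl ⟨0, rfl⟩
  | cons c p ih =>
    have hc := hp c (by simp)
    rcases ih fun d hd => hp d (by simp [hd]) with ⟨n, rfl⟩ | ⟨n, rfl⟩ | ⟨q, d, r, rfl⟩
    · rcases hc with rfl | rfl
      · cases n with
        | zero => exact Or.inl ⟨1, rfl⟩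
        | succ n => exact Or.inr (Or.inr ⟨[], c, altWord j c n, rfl⟩)
      · exact Or.inr (Or.inl ⟨n + 1, rfl⟩)
    · rcases hc with rfl | rfl
      · exact Or.inl ⟨n + 1, rfl⟩
      · cases n with
        | zero => exact Or.inr (Or.inl ⟨1, rfl⟩)
        | succ n => exact Or.inr (Or.inr ⟨[], c, altWord i c n, rfl⟩)
    · exact Or.inr (Or.inr ⟨c :: q, d, r, rfl⟩)

theorem exists_parabolic_factor {x : X} {a : List (Fin θ)} (ha : IsReduced R x a) (i j : Fin θ) :
    ∃ p v, wordMor R x (p ++ v) = wordMor R x a ∧ p.length + v.length = a.length ∧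
      ((∃ n, p = altWord i j n) ∨ ∃ n, p = altWord j i n) ∧
      IsReduced R (wsrc G p x) v ∧
      ¬IsDescent R (wsrc G p x) v i ∧ ¬IsDescent R (wsrc G p x) v j := by
  classical
  have hex : ∃ n, ∃ p v : List (Fin θ), v.length = n ∧ wordMor R x (p ++ v) = wordMor R x a ∧
      p.length + v.length = a.length ∧ ∀ c ∈ p, c = i ∨ c = j :=
    ⟨a.length, [], a, rfl, rfl, by simp, by simp⟩
  obtain ⟨p, v, hv, hpv, hl, hp⟩ := Nat.find_spec hex
  have hmin : ∀ c, c = i ∨ c = j → ¬IsDescent R (wsrc G p x) v c := by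
    rintro c hc ⟨b, hb, hbl⟩
    refine Nat.find_min hex (m := b.length) (by lia) ⟨p ++ [c], b, rfl, ?_, ?_, ?_⟩
    · rw [List.append_assoc, ← hpv]
      exact wordMor_append_congr_right p hb
    · simp
      lia
    · intro d hd
      rcases List.mem_append.mp hd with hd | hd
      · exact hp d hd
      · rw [List.mem_singleton.mp hd]
        exact hc
  have hred : IsReduced R x (p ++ v) := ha.of_wordMor_eq hpv (by simpa using hl)
  refine ⟨p, v, hpv, hl, ?_, hred.of_append, hmin i (Or.inl rfl), hmin j (Or.inr rfl)⟩
  rcases exists_altWord_or_repeat p hp with h | h | ⟨q, c, r, rfl⟩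
  · exact Or.inl h
  · exact Or.inr h
  · exfalso
    have h1 := hred (q ++ (r ++ v)) (by
      rw [List.append_assoc]
      exact wordMor_append_congr_right q (wordMor_cons_cons R _ c (r ++ v)).symm)
    simp at h1

theorem isDescent_of_mnum_le {x : X} {a v : List (Fin θ)} {i j : Fin θ} {n : ℕ}
    (h : wordMor R x (altWord j i n ++ v) = wordMor R x a) (hl : n + v.length = a.length)
    (hn : mnum G R x i j ≤ n) :
    ∃ r, wordMor R x (altWord i j (mnum G R x i j) ++ r) = wordMor R x a ∧
      mnum G R x i j + r.length = a.length := by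
  obtain ⟨d, hd⟩ := Nat.exists_eq_add_of_le hn
  rw [hd, altWord_add, List.append_assoc] at h
  refine ⟨_, (wordMor_append_congr_left _ (wordMor_braid R x i j)).trans h, ?_⟩
  rw [List.length_append, length_altWord]
  lia

theorem act_al_nonneg_of_not_isDescent {x : X} {a : List (Fin θ)} {i : Fin θ}
    (ha : IsReduced R x a) (hi : ¬IsDescent R x a i) : 0 ≤ act G a x (al θ i) := by
  induction hn : a.length using Nat.strong_induction_on generalizing x a i with
  | _ N ih =>
    subst hn
    cases a with
    | nil => exact al_nonneg i
    | cons j u =>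
      have hij : i ≠ j := by
        rintro rfl
        exact hi ⟨u, rfl, rfl⟩
      obtain ⟨p, v, hpv, hl, hp, hv, hvi, hvj⟩ := exists_parabolic_factor ha i j
      have hp0 : p.length ≠ 0 := by
        intro h0
        obtain rfl := List.length_eq_zero_iff.mp h0
        exact hvj ⟨u, hpv.symm, by simpa using hl.symm⟩
      have hvi' := ih v.length (by lia) hv hvi rfl
      have hvj' := ih v.length (by lia) hv hvj rfl
      rw [← act_eq_of_wordMor_eq hpv, act_append]
      refine map_pairCone_nonneg _ hvi' hvj' ?_
      rcases hp with ⟨n, rfl⟩ | ⟨n, rfl⟩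
      · cases n with
        | zero => exact absurd rfl hp0
        | succ n =>
          refine absurd ⟨altWord j i n ++ v, hpv, ?_⟩ hi
          rw [length_altWord] at hl
          simp only [List.length_append, length_altWord]
          lia
      · rw [length_altWord] at hl
        by_cases hn : n < mnum G R x i j
        · exact act_altWord_al_mem_pairCone R hij hn
        · obtain ⟨r, hr, hrl⟩ := isDescent_of_mnum_le hpv hl (not_lt.mp hn)
          obtain ⟨m, hm⟩ := Nat.exists_eq_succ_of_ne_zero (mnum_pos R x i j).ne'
          rw [hm] at hr hrl
          refine absurd ⟨altWord j i m ++ r, hr, ?_⟩ hi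
          simp only [List.length_append, length_altWord]
          lia

theorem act_al_nonpos_of_cons {x : X} {i : Fin θ} {b : List (Fin θ)}
    (h : IsReduced R x (i :: b)) : act G (i :: b) x (al θ i) ≤ 0 := by
  rw [act_cons_al_self, neg_nonpos]
  refine act_al_nonneg_of_not_isDescent (R := R) (IsReduced.of_append (p := [i]) h) ?_
  rintro ⟨c, hc, hcl⟩
  have h1 := wordMor_cons_congr (R := R) i hc
  rw [wordMor_cons_cons] at h1
  have h2 := h c h1
  rw [List.length_cons] at h2
  change c.length + 1 = b.length at hcl
  lia

theorem exists_long_altWord_prefix {x : X} {a : List (Fin θ)} {i j : Fin θ} (hij : i ≠ j)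
    (ha : IsReduced R x a) (hi : act G a x (al θ i) ≤ 0) (hj : act G a x (al θ j) ≤ 0) :
    ∃ n v, mnum G R x i j ≤ n ∧ n + v.length = a.length ∧
      (wordMor R x (altWord i j n ++ v) = wordMor R x a ∨
        wordMor R x (altWord j i n ++ v) = wordMor R x a) := by
  obtain ⟨p, v, hpv, hl, hp, hv, hvi, hvj⟩ := exists_parabolic_factor ha i j
  have hvi' := act_al_nonneg_of_not_isDescent hv hvi
  have hvj' := act_al_nonneg_of_not_isDescent hv hvj
  rw [← act_eq_of_wordMor_eq hpv, act_append] at hi hj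
  have hmem : ∀ k, act G v (wsrc G p x) (act G p x (al θ k)) ≠ 0 := fun k =>
    ne_zero_of_mem R k (act_mem R v (act_mem R p (al_mem R x k)))
  rcases hp with ⟨n, rfl⟩ | ⟨n, rfl⟩ <;> rw [length_altWord] at hl
  · refine ⟨n, v, ?_, hl, Or.inl hpv⟩
    by_contra! hn
    rw [mnum_comm] at hn
    exact hmem j (le_antisymm hj (map_pairCone_nonneg _ hvj' hvi'
      (act_altWord_al_mem_pairCone R hij.symm hn)))
  · refine ⟨n, v, ?_, hl, Or.inr hpv⟩
    by_contra! hn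
    exact hmem i (le_antisymm hi (map_pairCone_nonneg _ hvi' hvj'
      (act_altWord_al_mem_pairCone R hij hn)))

variable (𝕂 : Type) [CommRing 𝕂]

theorem nW_cons (x : X) (i : Fin θ) (a : List (Fin θ)) :
    nW G R 𝕂 (i :: a) x = nN G R 𝕂 x i * nW G R 𝕂 a (G.ρ i x) :=
  map_mul (RingQuot.mkAlgHom 𝕂 (nrel G R 𝕂)) _ _

theorem nW_nil (x : X) : nW G R 𝕂 [] x = 1 :=
  map_one (RingQuot.mkAlgHom 𝕂 (nrel G R 𝕂))

theorem nW_append (x : X) (a b : List (Fin θ)) :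
    nW G R 𝕂 (a ++ b) x = nW G R 𝕂 a x * nW G R 𝕂 b (wsrc G a x) := by
  induction a generalizing x with
  | nil =>
    rw [nW_nil, one_mul]
    rfl
  | cons i a ih =>
    rw [List.cons_append, nW_cons, nW_cons, ih, mul_assoc]
    rfl

theorem nW_braid (x : X) {i j : Fin θ} (hij : i ≠ j) :
    nW G R 𝕂 (altWord i j (mnum G R x i j)) x = nW G R 𝕂 (altWord j i (mnum G R x i j)) x :=
  RingQuot.mkAlgHom_rel 𝕂 (nrel.braid x i j hij)

theorem nW_eq_of_isReduced {x : X} {a b : List (Fin θ)} (ha : IsReduced R x a)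
    (h : wordMor R x b = wordMor R x a) (hl : b.length = a.length) :
    nW G R 𝕂 a x = nW G R 𝕂 b x := by
  induction hn : a.length generalizing x a b with
  | zero =>
    rw [hn] at hl
    rw [List.length_eq_zero_iff.mp hn, List.length_eq_zero_iff.mp hl]
  | succ n ih =>
    have cons_eq : ∀ {k : Fin θ} {u v : List (Fin θ)}, IsReduced R x (k :: u) →
        wordMor R x (k :: v) = wordMor R x (k :: u) → u.length = n → v.length = n →
        nW G R 𝕂 (k :: u) x = nW G R 𝕂 (k :: v) x := by
      intro k u v hu huv hul hvl
      rw [nW_cons, nW_cons, ih (x := G.ρ k x)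
        (IsReduced.of_append (p := [k]) hu) (wordMor_cons_cancel huv)
        (hvl.trans hul.symm) hul]
    obtain ⟨i, u, rfl⟩ := List.exists_cons_of_length_eq_add_one hn
    obtain ⟨j, v, rfl⟩ := List.exists_cons_of_length_eq_add_one (hl.trans hn)
    have hb := ha.of_wordMor_eq h hl
    simp only [List.length_cons, Nat.add_right_cancel_iff] at hl hn
    by_cases hij : i = j
    · subst hij
      exact cons_eq ha h hn (hl.trans hn)
    have hi := act_al_nonpos_of_cons ha
    have hj := act_al_nonpos_of_cons hb
    rw [act_eq_of_wordMor_eq h] at hj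
    obtain ⟨r, hr, hrl⟩ : ∃ r, wordMor R x (altWord i j (mnum G R x i j) ++ r) =
        wordMor R x (i :: u) ∧ mnum G R x i j + r.length = (i :: u).length := by
      obtain ⟨N, r, hN, hNl, hr | hr⟩ := exists_long_altWord_prefix hij ha hi hj
      · rw [mnum_comm] at hN
        obtain ⟨r, hr, hrl⟩ := isDescent_of_mnum_le hr hNl hN
        rw [mnum_comm] at hr hrl
        exact ⟨r, (wordMor_append_congr_left r (wordMor_braid R x i j)).trans hr, hrl⟩
      · exact isDescent_of_mnum_le hr hNl hN
    have hr' := (wordMor_append_congr_left r (wordMor_braid R x i j)).symm.trans hr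
    have hword : nW G R 𝕂 (altWord i j (mnum G R x i j) ++ r) x =
        nW G R 𝕂 (altWord j i (mnum G R x i j) ++ r) x := by
      rw [nW_append, nW_append, nW_braid 𝕂 x hij, wsrc_eq_of_wordMor_eq (wordMor_braid R x i j)]
    obtain ⟨m, hm⟩ := Nat.exists_eq_succ_of_ne_zero (mnum_pos R x i j).ne'
    rw [hm] at hr hr' hword hrl
    simp only [List.length_cons] at hrl
    rw [cons_eq (v := altWord j i m ++ r) ha hr hn
        (by rw [List.length_append, length_altWord]; lia),
      cons_eq (v := altWord i j m ++ r) hb (hr'.trans h.symm) (hl.trans hn)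
        (by rw [List.length_append, length_altWord]; lia)]
    exact hword

end RootCombinatorics

end WeylGroupoid


namespace WeylGroupoid

/-- **Independence of the reduced expression in the nil-Hecke algebra (Theorem 4.3).**
If `w ∈ 𝒲(y,x)` has length `m` and `w = σ_{i_1}^x ⋯ σ_{i_m} = σ_{j_1}^x ⋯ σ_{j_m}` are two
reduced expressions of `w`, then `n_{i_1}^x n_{i_2} ⋯ n_{i_m} = n_{j_1}^x n_{j_2} ⋯ n_{j_m}`
in the nil-Hecke algebra `𝒩`. -/
theorem nW_independent_of_reduced_expression {θ : ℕ} {X : Type} [Fintype X] [DecidableEq X]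
    (G : SCG θ X) (R : GRS G) (𝕂 : Type) [CommRing 𝕂]
    (y x : X) (w : homW G R y x) (m : ℕ) (hm : len G R w = m)
    (wi wj : List (Fin θ)) (hmi : wi.length = m) (hmj : wj.length = m)
    (hi : ∃ h : wsrc G wi x = y, castW G R h (morW G R wi x) = w)
    (hj : ∃ h : wsrc G wj x = y, castW G R h (morW G R wj x) = w) :
    nW G R 𝕂 wi x = nW G R 𝕂 wj x := by
  have hsig : ∀ a : List (Fin θ), (∃ h : wsrc G a x = y, castW G R h (morW G R a x) = w) ↔
      wordMor R x a = ⟨y, w⟩ := by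
    intro a
    constructor
    · rintro ⟨rfl, rfl⟩
      rfl
    · intro h
      cases h
      exact ⟨rfl, rfl⟩
  have hwi := (hsig wi).mp hi
  have hwj := (hsig wj).mp hj
  have hred : IsReduced R x wi := by
    intro b hb
    rw [hmi, ← hm]
    exact Nat.sInf_le ⟨b, rfl, (hsig b).mpr (hb.trans hwi)⟩
  exact nW_eq_of_isReduced 𝕂 hred (hwj.trans hwi.symm) (hmj.trans hmi.symm)

end WeylGroupoid
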